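/- Let X be an infinite-dimensional complex Banach space. Then every bounded linear operator T ∈ L(X) admits an essentially-invariant halfspace: there exist a halfspace Y of X and a compact operator K ∈ L(X) such that (T + K)Y ⊆ Y. -/

import Mathlib

/-- A halfspace of a Banach space `X`: a closed subspace of infinite dimension
and infinite codimension. -/
def IsHalfspace {X : Type*} [NormedAddCommGroup X] [NormedSpace ℂ X]
    (Y : Submodule ℂ X) : Prop :=
  IsClosed (Y : Set X) ∧ ¬FiniteDimensional ℂ Y ∧ ¬FiniteDimensional ℂ (X ⧸ Y)

open Filter Topology
open scoped BoundedContinuousFunction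

/-- Every bounded operator on a nontrivial complex Banach space has an approximate eigenvalue. -/
theorem exists_approximate_eigenvalue {E : Type*} [NormedAddCommGroup E] [NormedSpace ℂ E]
    [CompleteSpace E] [Nontrivial E] (A : E →L[ℂ] E) :
    ∃ l : ℂ, ∀ c > 0, ∃ x, ‖A x - l • x‖ < c * ‖x‖ := by
  have hne : (frontier (spectrum ℂ A)).Nonempty := by
    rw [nonempty_frontier_iff]
    refine ⟨spectrum.nonempty A, fun h => ?_⟩
    have := spectrum.isCompact (𝕜 := ℂ) A
    rw [h] at this
    exact noncompact_univ ℂ this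
  obtain ⟨l, hl⟩ := hne
  have hl' := hl
  rw [frontier_eq_closure_inter_closure] at hl'
  have hmem : l ∈ spectrum ℂ A := (spectrum.isClosed A).frontier_subset hl
  refine ⟨l, fun c hc => ?_⟩
  by_contra! hb
  obtain ⟨m, hm, hlm⟩ := Metric.mem_closure_iff.1 hl'.2 (c / 2) (by positivity)
  have hu : IsUnit (algebraMap ℂ (E →L[ℂ] E) m - A) := by
    simpa [spectrum.mem_iff] using hm
  obtain ⟨u, hu⟩ := hu
  rw [dist_eq_norm] at hlm
  have hbelow (x : E) : c / 2 * ‖x‖ ≤ ‖(u : E →L[ℂ] E) x‖ := by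
    have h1 := hb x
    have h2 : A x - l • x = -((u : E →L[ℂ] E) x) - (l - m) • x := by
      simp only [hu, Algebra.algebraMap_eq_smul_one, sub_smul]
      simp
    have h3 : ‖A x - l • x‖ ≤ ‖(u : E →L[ℂ] E) x‖ + ‖l - m‖ * ‖x‖ := by
      rw [h2]
      exact (norm_sub_le _ _).trans_eq (by rw [norm_neg, norm_smul])
    nlinarith [norm_nonneg x]
  have hinv : ‖(↑u⁻¹ : E →L[ℂ] E)‖ ≤ (c / 2)⁻¹ := by
    refine ContinuousLinearMap.opNorm_le_bound _ (by positivity) fun x => ?_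
    have h := hbelow ((↑u⁻¹ : E →L[ℂ] E) x)
    rw [← mul_apply_eq_comp, Units.mul_inv, one_apply_eq_self] at h
    rw [inv_mul_eq_div, le_div_iff₀ (by positivity)]
    linarith
  refine hmem ⟨u.ofNearby (algebraMap ℂ (E →L[ℂ] E) l - A) ?_, rfl⟩
  rw [hu, sub_sub_sub_cancel_right, ← map_sub, norm_algebraMap']
  refine hlm.trans_le ?_
  rwa [le_inv_comm₀ (by positivity) (Units.norm_pos _)]

/-- The bounded sequences that converge along the filter `U`. -/
def convergentAlong (X : Type*) [NormedAddCommGroup X] [NormedSpace ℂ X] (U : Filter ℕ) :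
    Submodule ℂ (ℕ →ᵇ X) where
  carrier := {f | ∃ a, Tendsto f U (𝓝 a)}
  add_mem' := by
    rintro f g ⟨a, ha⟩ ⟨b, hb⟩
    exact ⟨a + b, ha.add hb⟩
  zero_mem' := ⟨0, tendsto_const_nhds⟩
  smul_mem' := by
    rintro r f ⟨a, ha⟩
    exact ⟨r • a, ha.const_smul r⟩

theorem isClosed_convergentAlong {X : Type*} [NormedAddCommGroup X] [NormedSpace ℂ X]
    [CompleteSpace X] (U : Filter ℕ) [U.NeBot] :
    IsClosed (convergentAlong X U : Set (ℕ →ᵇ X)) := by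
  refine isClosed_of_closure_subset fun f hf => ?_
  suffices h : Cauchy (map f U) from CompleteSpace.complete h
  refine Metric.cauchy_iff.2 ⟨inferInstance, fun ε hε => ?_⟩
  obtain ⟨g, ⟨a, ha⟩, hfg⟩ := Metric.mem_closure_iff.1 hf (ε / 4) (by positivity)
  refine ⟨Metric.ball a (ε / 2), ?_, fun x hx y hy => ?_⟩
  · rw [Filter.mem_map]
    filter_upwards [Metric.tendsto_nhds.1 ha (ε / 4) (by positivity)] with n hn
    have h1 := BoundedContinuousFunction.dist_coe_le_dist (f := f) (g := g) n
    have h2 := dist_triangle (f n) (g n) a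
    simp only [Set.mem_preimage, Metric.mem_ball]
    linarith
  · have := dist_triangle_right x y a
    simp only [Metric.mem_ball] at hx hy
    linarith

theorem exists_approximate_eigenvalue_modulo_compact {X : Type*} [NormedAddCommGroup X]
    [NormedSpace ℂ X] [CompleteSpace X] (hX : ¬FiniteDimensional ℂ X) (T : X →L[ℂ] X) :
    ∃ l : ℂ, ∀ P : X →L[ℂ] X, IsCompactOperator P → ∀ c > 0,
      ∃ x, x ≠ 0 ∧ ‖P x‖ ≤ c * ‖x‖ ∧ ‖T x - l • x‖ ≤ c * ‖x‖ := by
  let U : Ultrafilter ℕ := hyperfilter ℕ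
  let M := convergentAlong X (U : Filter ℕ)
  have : IsClosed (M : Set (ℕ →ᵇ X)) := isClosed_convergentAlong _
  have hnt : Nontrivial ((ℕ →ᵇ X) ⧸ M) := by
    obtain ⟨R, f, -, hf, hsep⟩ := exists_seq_norm_le_one_le_norm_sub (𝕜 := ℂ) hX
    refine Submodule.Quotient.nontrivial_iff.2 fun h => ?_
    have hmem : BoundedContinuousFunction.ofNormedAddCommGroup f continuous_of_discreteTopology R hf
        ∈ M := h ▸ Submodule.mem_top
    obtain ⟨a, ha⟩ := hmem
    have hev := Metric.tendsto_nhds.1 ha (1 / 2) (by positivity)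
    obtain ⟨n, hn⟩ := hev.exists
    have hne : ∀ᶠ k in (U : Filter ℕ), k ≠ n :=
      hyperfilter_le_cofinite (Set.finite_singleton n).compl_mem_cofinite
    obtain ⟨k, hk, hkn⟩ := (hev.and hne).exists
    simp only [BoundedContinuousFunction.coe_ofNormedAddCommGroup] at hn hk
    have h1 := hsep hkn
    have h2 := dist_triangle_right (f k) (f n) a
    rw [dist_eq_norm] at h2
    linarith
  let S := T.compLeftContinuousBounded ℕ
  have hS : ∀ f ∈ M, S f ∈ M := by
    rintro f ⟨a, ha⟩
    exact ⟨T a, (T.continuous.tendsto a).comp ha⟩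
  let A₀ : ((ℕ →ᵇ X) ⧸ M) →ₗ[ℂ] ((ℕ →ᵇ X) ⧸ M) := M.mapQ M S.toLinearMap hS
  let A : ((ℕ →ᵇ X) ⧸ M) →L[ℂ] ((ℕ →ᵇ X) ⧸ M) := A₀.mkContinuous ‖S‖ fun x => by
    refine le_of_forall_pos_le_add fun ε hε => ?_
    obtain ⟨f, rfl, hf⟩ := Submodule.Quotient.norm_mk_lt x
      (show 0 < ε / (‖S‖ + 1) by positivity)
    have h1 : ‖A₀ (Submodule.Quotient.mk f)‖ ≤ ‖S f‖ := Submodule.Quotient.norm_mk_le _ _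
    have h2 := S.le_opNorm f
    have h3 := mul_le_mul_of_nonneg_left hf.le (norm_nonneg S)
    have h4 : ‖S‖ * (ε / (‖S‖ + 1)) ≤ ε := by
      rw [mul_div_assoc', div_le_iff₀ (by positivity)]
      nlinarith [norm_nonneg S]
    linarith
  obtain ⟨l, hl⟩ := exists_approximate_eigenvalue A
  refine ⟨l, fun P hP c hc => ?_⟩
  obtain ⟨x, hx⟩ := hl (c / 4) (by positivity)
  obtain ⟨f, rfl⟩ := Submodule.Quotient.mk_surjective _ x
  have hr : 0 < ‖(Submodule.Quotient.mk f : (ℕ →ᵇ X) ⧸ M)‖ := by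
    by_contra! h
    have := norm_nonneg (A (Submodule.Quotient.mk f) - l • Submodule.Quotient.mk f)
    nlinarith
  set r := ‖(Submodule.Quotient.mk f : (ℕ →ᵇ X) ⧸ M)‖ with hrdef
  obtain ⟨s, hs, hsn⟩ := Submodule.Quotient.norm_mk_lt
    (A (Submodule.Quotient.mk f) - l • Submodule.Quotient.mk f) (sub_pos.2 hx)
  rw [add_sub_cancel] at hsn
  have hsM : (S f - l • f) - s ∈ M := (Submodule.Quotient.eq M).1 hs.symm
  obtain ⟨a, ha⟩ := hsM
  obtain ⟨C, hC, hPC⟩ := hP.image_subset_compact_of_bounded (f := (P : X →ₗ[ℂ] X))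
    f.isBounded_range
  obtain ⟨b, -, hb⟩ := hC.ultrafilter_le_nhds' (U.map fun n => P (f n)) (by
    refine Filter.mem_map.2 (Filter.univ_mem' fun n => hPC ⟨f n, ⟨n, rfl⟩, rfl⟩))
  have hb' : Tendsto (fun n => P (f n)) U (𝓝 b) := hb
  have hcr : 0 < c / 4 * r := by positivity
  have hev : ∀ᶠ n in (U : Filter ℕ),
      ‖T (f n) - l • f n - a‖ < c / 4 * r ∧ ‖P (f n) - b‖ < c / 4 * r := by
    have hlt := sub_pos.2 hsn
    filter_upwards [Metric.tendsto_nhds.1 ha _ hlt, Metric.tendsto_nhds.1 hb' _ hcr]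
      with n h1 h2
    rw [dist_eq_norm] at h1 h2
    refine ⟨?_, h2⟩
    have h3 : T (f n) - l • f n - a = ((S f - l • f) - s) n - a + s n := by
      simp [S]
      abel
    rw [h3]
    have h4 := norm_add_le (((S f - l • f) - s) n - a) (s n)
    have h5 := s.norm_coe_le_norm n
    linarith
  obtain ⟨n, hn1, hn2⟩ := hev.exists
  have hfreq : ∃ᶠ k in (U : Filter ℕ), r / 2 ≤ ‖f k - f n‖ := by
    intro hcon
    simp only [not_le] at hcon
    classical
    let g : ℕ →ᵇ X := BoundedContinuousFunction.ofNormedAddCommGroup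
      (fun k => if ‖f k - f n‖ < r / 2 then f k - f n else 0) continuous_of_discreteTopology (r / 2)
      (fun k => by
        split_ifs with h
        · exact h.le
        · rw [norm_zero]
          positivity)
    have hg : f - g ∈ M := by
      refine ⟨f n, tendsto_const_nhds.congr' ?_⟩
      filter_upwards [hcon] with k hk
      simp [g, hk]
    have h1 : (Submodule.Quotient.mk f : (ℕ →ᵇ X) ⧸ M) = Submodule.Quotient.mk g :=
      (Submodule.Quotient.eq M).2 hg
    have h2 : r ≤ ‖g‖ := by
      rw [hrdef, h1]
      exact Submodule.Quotient.norm_mk_le _ _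
    have h3 : ‖g‖ ≤ r / 2 :=
      BoundedContinuousFunction.norm_ofNormedAddCommGroup_le _ (by positivity) _
    linarith
  obtain ⟨k, hk, hk1, hk2⟩ := (hfreq.and_eventually hev).exists
  refine ⟨f k - f n, fun h => ?_, ?_, ?_⟩
  · rw [h, norm_zero] at hk
    linarith
  · have h1 : P (f k - f n) = (P (f k) - b) - (P (f n) - b) := by simp
    have h2 := norm_sub_le (P (f k) - b) (P (f n) - b)
    rw [h1]
    nlinarith
  · have h1 : T (f k - f n) - l • (f k - f n)
        = (T (f k) - l • f k - a) - (T (f n) - l • f n - a) := by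
      rw [map_sub, smul_sub]
      abel
    have h2 := norm_sub_le (T (f k) - l • f k - a) (T (f n) - l • f n - a)
    rw [h1]
    nlinarith

theorem isCompactOperator_smulRight {X : Type*} [NormedAddCommGroup X] [NormedSpace ℂ X]
    (g : StrongDual ℂ X) (v : X) : IsCompactOperator (g.smulRight v) :=
  (isCompactOperator_of_locallyCompactSpace_dom g).clm_comp (ContinuousLinearMap.toSpanSingleton ℂ v)

theorem exists_nearly_annihilated_vector {X : Type*} [NormedAddCommGroup X]
    [NormedSpace ℂ X] {T : X →L[ℂ] X} {l : ℂ} {P : X →L[ℂ] X} (hPP : ∀ x, P (P x) = P x)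
    (h : ∀ c > 0, ∃ x, x ≠ 0 ∧ ‖P x‖ ≤ c * ‖x‖ ∧ ‖T x - l • x‖ ≤ c * ‖x‖)
    {ε : ℝ} (hε : 0 < ε) :
    ∃ (x : X) (g : StrongDual ℂ X), P x = 0 ∧ g x = 1 ∧ (∀ z, g (P z) = 0) ∧
      ‖g‖ * ‖T x - l • x‖ ≤ ε := by
  let D : X →L[ℂ] X := T - l • ContinuousLinearMap.id ℂ X
  let Q : X →L[ℂ] X := ContinuousLinearMap.id ℂ X - P
  have hD (x : X) : T x - l • x = D x := by simp [D]
  set B : ℝ := 2 * ‖Q‖ * (1 + ‖D‖) + 1 with hB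
  have hBpos : 0 < B := by positivity
  obtain ⟨w, hw, hPw, hTw⟩ := h (min (1 / 2) (ε / B)) (by positivity)
  have hwpos : 0 < ‖w‖ := norm_pos_iff.2 hw
  have hPw2 : ‖P w‖ ≤ 1 / 2 * ‖w‖ := hPw.trans (by gcongr; exact min_le_left _ _)
  have hPw3 : ‖P w‖ ≤ ε / B * ‖w‖ := hPw.trans (by gcongr; exact min_le_right _ _)
  have hTw3 : ‖D w‖ ≤ ε / B * ‖w‖ := hD w ▸ hTw.trans (by gcongr; exact min_le_right _ _)
  have hx : ‖w‖ / 2 ≤ ‖Q w‖ := by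
    have := norm_sub_norm_le w (P w)
    have h' : Q w = w - P w := by simp [Q]
    rw [h']
    linarith
  have hxpos : 0 < ‖Q w‖ := by linarith
  have hPQ (z : X) : P (Q z) = 0 := by simp [Q, hPP]
  have hQP (z : X) : Q (P z) = 0 := by simp [Q, hPP]
  have hQQ (z : X) : Q (Q z) = Q z := by simp [Q, hPP]
  obtain ⟨f, hf, hfx⟩ := exists_dual_vector'' ℂ (Q w)
  have hxC : ((‖Q w‖ : ℝ) : ℂ) ≠ 0 := by exact_mod_cast hxpos.ne'
  refine ⟨Q w, ((‖Q w‖ : ℂ)⁻¹) • f.comp Q, hPQ w, ?_, fun z => ?_, ?_⟩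
  · simp only [FunLike.coe_smul, Pi.smul_apply, ContinuousLinearMap.comp_apply, hQQ, hfx,
      smul_eq_mul]
    exact inv_mul_cancel₀ hxC
  · simp [hQP]
  · have h1 : ‖(‖Q w‖ : ℂ)⁻¹ • f.comp Q‖ ≤ ‖Q w‖⁻¹ * ‖Q‖ := by
      rw [norm_smul, norm_inv, Complex.norm_real, norm_norm]
      gcongr
      exact (f.opNorm_comp_le Q).trans (mul_le_of_le_one_left (norm_nonneg _) hf)
    have h2 : ‖T (Q w) - l • Q w‖ ≤ (1 + ‖D‖) * (ε / B * ‖w‖) := by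
      have h3 : D (Q w) = D w - D (P w) := by simp [Q]
      rw [hD, h3]
      have h4 := norm_sub_le (D w) (D (P w))
      have h5 := D.le_opNorm (P w)
      have h6 := mul_le_mul_of_nonneg_left hPw3 (norm_nonneg D)
      linarith
    calc _ ≤ ‖Q w‖⁻¹ * ‖Q‖ * ((1 + ‖D‖) * (ε / B * ‖w‖)) := by gcongr
      _ = (‖w‖ * ‖Q w‖⁻¹) * (‖Q‖ * (1 + ‖D‖) * (ε / B)) := by ring
      _ ≤ 2 * (‖Q‖ * (1 + ‖D‖) * (ε / B)) := by
        gcongr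
        rw [← div_eq_mul_inv, div_le_iff₀ hxpos]
        linarith
      _ = (2 * ‖Q‖ * (1 + ‖D‖)) / B * ε := by ring
      _ ≤ 1 * ε := by
        gcongr
        rw [div_le_one hBpos, hB]
        linarith
      _ = ε := one_mul ε

/-- Every operator is a scalar up to small errors along the vectors of some biorthogonal system. -/
theorem exists_biorthogonal_almost_eigenvectors {X : Type*} [NormedAddCommGroup X]
    [NormedSpace ℂ X] [CompleteSpace X] (hX : ¬FiniteDimensional ℂ X) (T : X →L[ℂ] X) :
    ∃ (l : ℂ) (x : ℕ → X) (g : ℕ → StrongDual ℂ X),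
      (∀ m n, g m (x n) = if m = n then 1 else 0) ∧
      ∀ n, ‖g n‖ * ‖T (x n) - l • x n‖ ≤ (1 / 2) ^ n := by
  obtain ⟨l, hl⟩ := exists_approximate_eigenvalue_modulo_compact hX T
  have step (n : ℕ) (P : {P : X →L[ℂ] X // IsCompactOperator P ∧ ∀ x, P (P x) = P x}) :=
    exists_nearly_annihilated_vector P.2.2 (hl P.1 P.2.1) (ε := (1 / 2) ^ n) (by positivity)
  choose x g hPx hgx hgP hsmall using step
  let p : ℕ → {P : X →L[ℂ] X // IsCompactOperator P ∧ ∀ x, P (P x) = P x} := fun n =>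
    Nat.rec ⟨0, isCompactOperator_zero, fun x => by simp⟩
      (fun n P => ⟨P.1 + (g n P).smulRight (x n P),
        P.2.1.add (isCompactOperator_smulRight _ _), fun z => by
          simp [P.2.2, hPx, hgx, hgP]⟩) n
  have hp (n : ℕ) (z : X) :
      (p (n + 1)).1 z = (p n).1 z + g n (p n) z • x n (p n) := rfl
  refine ⟨l, fun n => x n (p n), fun n => g n (p n), fun m n => ?_, fun n => hsmall n _⟩
  have hfix (n k : ℕ) : (p (n + 1 + k)).1 (x n (p n)) = x n (p n) := by
    induction k with
    | zero => simp [hp, hPx, hgx]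
    | succ k ih =>
      have h0 := hgP (n + 1 + k) (p (n + 1 + k)) (x n (p n))
      rw [ih] at h0
      rw [← add_assoc, hp, ih, h0, zero_smul, add_zero]
  have habs (m k : ℕ) (z : X) : g m (p m) ((p (m + 1 + k)).1 z) = g m (p m) z := by
    induction k generalizing z with
    | zero => simp [hp, hgP, hgx]
    | succ k ih =>
      have h0 := ih (x (m + 1 + k) (p (m + 1 + k)))
      rw [hPx, map_zero] at h0
      rw [← add_assoc, hp, map_add, ih, map_smul, ← h0, smul_zero, add_zero]
  rcases lt_trichotomy m n with h | rfl | h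
  · obtain ⟨k, rfl⟩ := Nat.exists_eq_add_of_le (Nat.succ_le_of_lt h)
    rw [if_neg h.ne, ← habs m k, hPx, map_zero]
  · simp [hgx]
  · obtain ⟨k, rfl⟩ := Nat.exists_eq_add_of_le (Nat.succ_le_of_lt h)
    have h0 := hgP (n + 1 + k) (p (n + 1 + k)) (x n (p n))
    rw [hfix] at h0
    rw [if_neg h.ne']
    exact h0

theorem not_finiteDimensional_of_biorthogonal {V : Type*} [AddCommGroup V] [Module ℂ V]
    {v : ℕ → V} {f : ℕ → V →ₗ[ℂ] ℂ} (h : ∀ m n, f m (v n) = if m = n then 1 else 0) :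
    ¬FiniteDimensional ℂ V := by
  intro hV
  have hli : LinearIndependent ℂ v := by
    refine linearIndependent_iff'.2 fun s a ha i hi => ?_
    simpa [h, hi] using congrArg (f i) ha
  have := hli.finite
  exact not_finite ℕ

/-- Every operator on an infinite-dimensional complex Banach space admits an
essentially-invariant halfspace: a halfspace `Y` with `(T + K) Y ⊆ Y` for some
compact operator `K`. -/
theorem exists_essentially_invariant_halfspace
    {X : Type*} [NormedAddCommGroup X] [NormedSpace ℂ X] [CompleteSpace X]
    (hX : ¬FiniteDimensional ℂ X) (T : X →L[ℂ] X) :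
    ∃ Y : Submodule ℂ X, IsHalfspace Y ∧
      ∃ K : X →L[ℂ] X, IsCompactOperator ⇑K ∧ ∀ y ∈ Y, T y + K y ∈ Y := by
  obtain ⟨l, x, g, hgx, hsmall⟩ := exists_biorthogonal_almost_eigenvectors hX T
  let R : ℕ → X →L[ℂ] X := fun n => (g n).smulRight (l • x n - T (x n))
  have hR : Summable R := by
    refine Summable.of_norm_bounded summable_geometric_two fun n => ?_
    rw [ContinuousLinearMap.norm_smulRight_apply, norm_sub_rev]
    exact hsmall n
  obtain ⟨K, hRK⟩ := hR
  have hK : IsCompactOperator K := by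
    refine isCompactOperator_of_tendsto hRK (Eventually.of_forall fun s => ?_)
    induction s using Finset.induction_on with
    | empty => simpa using isCompactOperator_zero
    | insert a s ha ih =>
      rw [Finset.sum_insert ha]
      exact (isCompactOperator_smulRight _ _).add ih
  have hKx (n : ℕ) : K (x n) = l • x n - T (x n) := by
    have h1 : HasSum (fun m => R m (x n)) (K (x n)) := by
      simpa using (ContinuousLinearMap.apply ℂ X (x n)).hasSum hRK
    have h2 := hasSum_single (f := fun m => R m (x n)) n fun m hm => by simp [R, hgx, hm]
    rw [h1.unique h2]
    simp [R, hgx]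
  let Y := (Submodule.span ℂ (Set.range fun n => x (2 * n))).topologicalClosure
  have hxY (n : ℕ) : x (2 * n) ∈ Y :=
    Submodule.le_topologicalClosure _ (Submodule.subset_span ⟨n, rfl⟩)
  have hY (S : X →L[ℂ] X) (hS : ∀ n, S (x (2 * n)) = 0) : ∀ y ∈ Y, S y = 0 := by
    have : Y ≤ LinearMap.ker (S : X →ₗ[ℂ] X) := by
      refine Submodule.topologicalClosure_minimal _ ?_ S.isClosed_ker
      rw [Submodule.span_le]
      rintro _ ⟨n, rfl⟩
      exact hS n
    exact this
  refine ⟨Y, ⟨Submodule.isClosed_topologicalClosure _, ?_, ?_⟩, K, hK, fun y hy => ?_⟩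
  · refine not_finiteDimensional_of_biorthogonal (v := fun n => ⟨x (2 * n), hxY n⟩)
      (f := fun n => (g (2 * n) : X →ₗ[ℂ] ℂ).comp Y.subtype) fun m n => ?_
    simp [hgx]
  · have hg (n : ℕ) : Y ≤ LinearMap.ker (g (2 * n + 1) : X →ₗ[ℂ] ℂ) := by
      refine Submodule.topologicalClosure_minimal _ ?_ (g (2 * n + 1)).isClosed_ker
      rw [Submodule.span_le]
      rintro _ ⟨k, rfl⟩
      have : 2 * n + 1 ≠ 2 * k := by lia
      simp [hgx, this]
    refine not_finiteDimensional_of_biorthogonal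
      (v := fun n => (Submodule.Quotient.mk (x (2 * n + 1)) : X ⧸ Y))
      (f := fun n => Y.liftQ (g (2 * n + 1) : X →ₗ[ℂ] ℂ) (hg n)) fun m n => ?_
    simp [hgx]
  · have h := hY (T + K - l • ContinuousLinearMap.id ℂ X) (fun n => by simp [hKx]) y hy
    have h' : T y + K y = l • y := by simpa [sub_eq_zero] using h
    rw [h']
    exact Y.smul_mem l hy
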